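/- arXiv:math/0301372 — 9 statements merged into one kernel-verified Lean document; each statement's English description precedes it below -/
import Mathlib

section
/- For every vertex i of a tree T on a finite set I, the derivation θ_i is logarithmic for the arrangement H_T; that is, for all j, k ∈ I with j <_T k, the polynomial (x_j − x_k) divides θ_i(x_j) − θ_i(x_k) in MvPolynomial I ℂ. -/
/-- A forest on `I`: a partial order on `I` such that the set of elements below any
element is totally ordered (a chain). A *tree* is a forest with a unique minimal
element (the root), see `Forest.IsTree`. -/
structure Forest (I : Type*) where
  le : I → I → Prop
  le_refl : ∀ i, le i i
  le_trans : ∀ ⦃i j k⦄, le i j → le j k → le i k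
  le_antisymm : ∀ ⦃i j⦄, le i j → le j i → i = j
  downset_chain : ∀ ⦃i j k⦄, le j i → le k i → le j k ∨ le k j

namespace Forest

variable {I : Type*}

/-- Strict order associated to a forest. -/
def lt (F : Forest I) (i j : I) : Prop := F.le i j ∧ i ≠ j

/-- A tree is a forest with a (necessarily unique) minimal element lying below
every vertex. -/
def IsTree (T : Forest I) : Prop := ∃ r : I, ∀ i, T.le r i

end Forest

noncomputable section

open MvPolynomial
open scoped Classical

/-- The derivation `θ_i` of `MvPolynomial I ℂ` determined by
`θ_i(x_j) = ∏_{k <_T i} (x_k - x_j)` if `i ≤_T j` and `0` otherwise. -/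
def theta {I : Type*} [Fintype I] (T : Forest I) (i : I) :
    Derivation ℂ (MvPolynomial I ℂ) (MvPolynomial I ℂ) :=
  MvPolynomial.mkDerivation ℂ (fun j =>
    if T.le i j then
      ∏ k ∈ Finset.univ.filter (fun k => T.lt k i), (X k - X j)
    else 0)

theorem sub_dvd_prod_sub_sub_prod_sub {R ι : Type*} [CommRing R] (s : Finset ι) (f : ι → R)
    (a b : R) : a - b ∣ ∏ l ∈ s, (f l - a) - ∏ l ∈ s, (f l - b) := by
  induction s using Finset.cons_induction with
  | empty => simp
  | cons m s hm ih =>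
    obtain ⟨c, hc⟩ := ih
    rw [Finset.prod_cons, Finset.prod_cons]
    exact ⟨(f m - a) * c - ∏ l ∈ s, (f l - b), by linear_combination (f m - a) * hc⟩

/-- for every vertex `i` of a tree `T` on a finite set `I`, the
derivation `θ_i` is logarithmic for the arrangement `H_T`: for all `j <_T k`,
the polynomial `x_j - x_k` divides `θ_i(x_j) - θ_i(x_k)`. -/
theorem theta_logarithmic {I : Type*} [Fintype I] (T : Forest I) (hT : T.IsTree)
    (i j k : I) (hjk : T.lt j k) :
    (X j - X k : MvPolynomial I ℂ) ∣ theta T i (X j) - theta T i (X k) := by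
  simp only [theta, mkDerivation_X]
  by_cases hij : T.le i j
  · rw [if_pos hij, if_pos (T.le_trans hij hjk.1)]
    exact sub_dvd_prod_sub_sub_prod_sub _ _ _ _
  · rw [if_neg hij, zero_sub, dvd_neg]
    split_ifs with hik
    · have hji : T.lt j i :=
        ⟨(T.downset_chain hik hjk.1).resolve_left hij, fun h => hij (h ▸ T.le_refl j)⟩
      exact Finset.dvd_prod_of_mem (fun l => (X l - X k : MvPolynomial I ℂ))
        (Finset.mem_filter.mpr ⟨Finset.mem_univ j, hji⟩)
    · exact dvd_zero _

end
end

section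
/- Let T be a tree on a finite set I (with decidable equality and a fintype structure on I). The determinant of the I × I matrix whose (i,j) entry is θ_i(x_j) equals Q_T = ∏_{(i,j) : i <_T j} (x_i − x_j), the defining form of the arrangement H_T. -/
noncomputable section

open MvPolynomial
open scoped Classical

/-- The defining form `Q_T = ∏_{i <_T j} (x_i - x_j)` of the arrangement `H_T`. -/
def definingForm {I : Type*} [Fintype I] (T : Forest I) : MvPolynomial I ℂ :=
  ∏ p ∈ Finset.univ.filter (fun p : I × I => T.lt p.1 p.2), (X p.1 - X p.2)

theorem Matrix.det_eq_prod_diag_of_forall_not_le {m R : Type*} [CommRing R] [Fintype m]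
    [DecidableEq m] [PartialOrder m] (M : Matrix m m R) (h : ∀ i j, ¬ i ≤ j → M i j = 0) :
    M.det = ∏ i, M i i := by
  obtain ⟨s, hs, hle⟩ := extend_partialOrder ((· ≤ ·) : m → m → Prop)
  let L : LinearOrder m :=
    { le := s
      lt := fun a b => s a b ∧ ¬ s b a
      lt_iff_le_not_ge := fun _ _ => Iff.rfl
      le_refl := hs.refl
      le_trans := hs.trans
      le_antisymm := hs.antisymm
      le_total := hs.total
      toDecidableLE := Classical.decRel _ }
  have hM : @Matrix.IsUpperTriangular m R _ L.toLT M := fun i j hij =>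
    h i j fun hle' => hij.2 (hle i j hle')
  exact @Matrix.det_of_isUpperTriangular m R M _ _ _ L hM

/-- The partial order underlying a forest. -/
abbrev Forest.toPartialOrder {I : Type*} (F : Forest I) : PartialOrder I where
  le := F.le
  le_refl := F.le_refl
  le_trans := fun _ _ _ h₁ h₂ => F.le_trans h₁ h₂
  le_antisymm := fun _ _ h₁ h₂ => F.le_antisymm h₁ h₂

theorem theta_X {I : Type*} [Fintype I] (T : Forest I) (i j : I) :
    theta T i (X j) = if T.le i j then
      ∏ k ∈ Finset.univ.filter (fun k => T.lt k i), (X k - X j) else 0 :=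
  mkDerivation_X ℂ _ j

theorem definingForm_eq_prod_prod {I : Type*} [Fintype I] (T : Forest I) :
    definingForm T =
      ∏ i : I, ∏ k ∈ Finset.univ.filter (fun k => T.lt k i), (X k - X i) := by
  simp only [definingForm, Finset.prod_filter, Fintype.prod_prod_type_right]

/-- the determinant of the matrix `[θ_i(x_j)]` is the defining form
`Q_T = ∏_{i <_T j} (x_i - x_j)` of the arrangement `H_T`. -/
theorem det_theta_eq_definingForm {I : Type*} [Fintype I] [DecidableEq I]
    (T : Forest I) (hT : T.IsTree) :
    Matrix.det (Matrix.of fun i j : I => theta T i (X j)) = definingForm T := by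
  let _ := T.toPartialOrder
  rw [Matrix.det_eq_prod_diag_of_forall_not_le, definingForm_eq_prod_prod]
  · exact Finset.prod_congr rfl fun i _ => by
      rw [Matrix.of_apply, theta_X, if_pos (T.le_refl i)]
  · intro i j hij
    rw [Matrix.of_apply, theta_X, if_neg (show ¬ T.le i j from hij)]

end
end

section
/- Let T be a tree on a finite set I. Then the 1-forms ω_i are logarithmic for H_T: (a) for every i ∈ I and every j ≤_T i, the element Q_T · c_{i,j} of the fraction field K lies in (the image of) R; (b) for every i ∈ I and all distinct j, k with j ≤_T i and k ≤_T i, the element Q_T · (A_j − A_k) · (x_k − x_j)^{−2} of K lies in (the image of) R, where A_j = ∏_{ℓ : ℓ ≤_T i, ℓ ≠ j, ℓ ≠ k} (x_ℓ − x_j)^{−1} and A_k = ∏_{ℓ : ℓ ≤_T i, ℓ ≠ j, ℓ ≠ k} (x_ℓ − x_k)^{−1}. (These are the coefficients of Q_T ω_i and of Q_T dω_i.) -/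
noncomputable section

open MvPolynomial
open scoped Classical

/-- The coefficient `c_{i,j} = ∏_{k ≤_T i, k ≠ j} (x_k - x_j)⁻¹` of `dx_j` in the
logarithmic 1-form `ω_i`, as an element of the fraction field `K` of
`MvPolynomial I ℂ`. -/
def omegaCoeff {I : Type*} [Fintype I] (T : Forest I) (i j : I) :
    FractionRing (MvPolynomial I ℂ) :=
  ∏ k ∈ Finset.univ.filter (fun k => T.le k i ∧ k ≠ j),
    (algebraMap (MvPolynomial I ℂ) (FractionRing (MvPolynomial I ℂ)) (X k - X j))⁻¹

/-- A set of pairs of distinct comparable vertices, containing no pair together with its swap,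
gives a product of linear forms dividing the defining form. -/
theorem prod_sub_dvd_definingForm {I : Type*} [Fintype I] (T : Forest I) (E : Finset (I × I))
    (hcomp : ∀ p ∈ E, T.le p.1 p.2 ∨ T.le p.2 p.1) (hne : ∀ p ∈ E, p.1 ≠ p.2)
    (hswap : ∀ p ∈ E, p.swap ∉ E) :
    ∏ p ∈ E, (X p.1 - X p.2 : MvPolynomial I ℂ) ∣ definingForm T := by
  let o : I × I → I × I := fun p => if T.le p.1 p.2 then p else p.swap
  have ho : ∀ p, o p = p ∨ o p = p.swap := fun p => by
    by_cases h : T.le p.1 p.2 <;> simp [o, h]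
  have hinj : Set.InjOn o E := by
    intro p hp q hq hpq
    rcases ho p with h | h <;> rcases ho q with h' | h' <;> rw [h, h'] at hpq
    · exact hpq
    · exact absurd (hpq ▸ hp) (hswap q hq)
    · exact absurd (hpq ▸ hq) (hswap p hp)
    · exact Prod.swap_injective hpq
  calc ∏ p ∈ E, (X p.1 - X p.2 : MvPolynomial I ℂ)
      ∣ ∏ p ∈ E, (X (o p).1 - X (o p).2) := by
        refine Finset.prod_dvd_prod_of_dvd _ _ fun p _ => ?_
        rcases ho p with h | h <;> rw [h]
        rw [Prod.fst_swap, Prod.snd_swap, ← dvd_neg, neg_sub]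
    _ = ∏ p ∈ E.image o, (X p.1 - X p.2) := by
        rw [Finset.prod_image hinj]
    _ ∣ definingForm T := by
        refine Finset.prod_dvd_prod_of_subset _ _ _ fun q hq => ?_
        obtain ⟨p, hp, rfl⟩ := Finset.mem_image.mp hq
        rw [Finset.mem_filter]
        refine ⟨Finset.mem_univ _, ?_⟩
        by_cases h : T.le p.1 p.2
        · simpa [o, h, Forest.lt] using hne p hp
        · simpa [o, h, Forest.lt] using ⟨(hcomp p hp).resolve_left h, (hne p hp).symm⟩

/-- The difference of two distinct variables is nonzero in the fraction field. -/
theorem algebraMap_X_sub_X_ne_zero {I : Type*} {i j : I} (h : i ≠ j) :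
    algebraMap (MvPolynomial I ℂ) (FractionRing (MvPolynomial I ℂ)) (X i - X j) ≠ 0 := by
  rw [Ne, FaithfulSMul.algebraMap_eq_zero_iff, sub_eq_zero]
  exact fun e => h (X_injective e)

/-- the 1-forms `ω_i` are logarithmic for `H_T`:
(a) `Q_T · c_{i,j}` is a polynomial for all `j ≤_T i`;
(b) `Q_T · (A_j - A_k) · (x_k - x_j)⁻²` is a polynomial for distinct `j, k ≤_T i`,
where `A_j, A_k` are the indicated products; these are the coefficients of
`Q_T ω_i` and of `Q_T dω_i`. -/
theorem omega_logarithmic {I : Type*} [Fintype I] (T : Forest I) (hT : T.IsTree) :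
    (∀ i j : I, T.le j i →
      algebraMap (MvPolynomial I ℂ) (FractionRing (MvPolynomial I ℂ)) (definingForm T)
          * omegaCoeff T i j
        ∈ (algebraMap (MvPolynomial I ℂ) (FractionRing (MvPolynomial I ℂ))).range) ∧
    (∀ i j k : I, T.le j i → T.le k i → j ≠ k →
      algebraMap (MvPolynomial I ℂ) (FractionRing (MvPolynomial I ℂ)) (definingForm T)
          * ((∏ l ∈ Finset.univ.filter (fun l => T.le l i ∧ l ≠ j ∧ l ≠ k),
                (algebraMap (MvPolynomial I ℂ) (FractionRing (MvPolynomial I ℂ))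
                  (X l - X j))⁻¹)
             - ∏ l ∈ Finset.univ.filter (fun l => T.le l i ∧ l ≠ j ∧ l ≠ k),
                (algebraMap (MvPolynomial I ℂ) (FractionRing (MvPolynomial I ℂ))
                  (X l - X k))⁻¹)
          * ((algebraMap (MvPolynomial I ℂ) (FractionRing (MvPolynomial I ℂ))
                (X k - X j)) ^ 2)⁻¹
        ∈ (algebraMap (MvPolynomial I ℂ) (FractionRing (MvPolynomial I ℂ))).range) := by
  constructor
  · intro i j hj
    set s := Finset.univ.filter (fun k => T.le k i ∧ k ≠ j) with hs
    have hdvd := prod_sub_dvd_definingForm T (s ×ˢ {j})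
      (by
        rintro ⟨a, b⟩ hp
        simp only [hs, Finset.mem_product, Finset.mem_filter, Finset.mem_singleton] at hp
        obtain ⟨⟨-, ha, -⟩, rfl⟩ := hp
        exact T.downset_chain ha hj)
      (by rintro ⟨a, b⟩ hp; simp [hs] at hp ⊢; grind)
      (by rintro ⟨a, b⟩ hp; simp [hs] at hp ⊢; grind)
    obtain ⟨c, hc⟩ := hdvd
    rw [Finset.prod_product] at hc
    simp only [Finset.prod_singleton] at hc
    have h0 : ∏ k ∈ s, algebraMap (MvPolynomial I ℂ) (FractionRing (MvPolynomial I ℂ))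
        (X k - X j) ≠ 0 :=
      Finset.prod_ne_zero_iff.mpr fun k hk =>
        algebraMap_X_sub_X_ne_zero (Finset.mem_filter.mp hk).2.2
    refine ⟨c, ?_⟩
    rw [omegaCoeff, ← hs, Finset.prod_inv_distrib, hc, map_mul, map_prod]
    field_simp
  · intro i j k hj hk hjk
    set s := Finset.univ.filter (fun l => T.le l i ∧ l ≠ j ∧ l ≠ k) with hs
    have hmem : ∀ l ∈ s, T.le l i ∧ l ≠ j ∧ l ≠ k := fun l hl => (Finset.mem_filter.mp hl).2
    have hnot : (k, j) ∉ s ×ˢ {j, k} := by simp [hs]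
    have hdvd := prod_sub_dvd_definingForm T (insert (k, j) (s ×ˢ {j, k}))
      (by
        rintro ⟨a, b⟩ hp
        simp only [Finset.mem_insert, Finset.mem_product, Finset.mem_singleton,
          Prod.mk.injEq] at hp
        rcases hp with ⟨rfl, rfl⟩ | ⟨ha, rfl | rfl⟩
        · exact T.downset_chain hk hj
        · exact T.downset_chain (hmem a ha).1 hj
        · exact T.downset_chain (hmem a ha).1 hk)
      (by
        rintro ⟨a, b⟩ hp
        simp only [Finset.mem_insert, Finset.mem_product, Finset.mem_singleton,
          Prod.mk.injEq] at hp
        grind)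
      (by
        rintro ⟨a, b⟩ hp
        simp only [Finset.mem_insert, Finset.mem_product, Finset.mem_singleton,
          Prod.mk.injEq, Prod.swap_prod_mk] at hp ⊢
        grind)
    obtain ⟨c, hc⟩ := hdvd
    rw [Finset.prod_insert hnot, Finset.prod_product] at hc
    simp only [Finset.prod_pair hjk, Finset.prod_mul_distrib] at hc
    obtain ⟨d, hd⟩ := sub_dvd_prod_sub_sub_prod_sub s
      (fun l => (X l : MvPolynomial I ℂ)) (X k) (X j)
    replace hd := congrArg
      (algebraMap (MvPolynomial I ℂ) (FractionRing (MvPolynomial I ℂ))) hd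
    rw [map_sub, map_mul, map_prod, map_prod] at hd
    have hP : ∀ m, (∀ l ∈ s, l ≠ m) →
        ∏ l ∈ s, algebraMap (MvPolynomial I ℂ) (FractionRing (MvPolynomial I ℂ))
          (X l - X m) ≠ 0 := fun m hm =>
      Finset.prod_ne_zero_iff.mpr fun l hl => algebraMap_X_sub_X_ne_zero (hm l hl)
    have hPj := hP j fun l hl => (hmem l hl).2.1
    have hPk := hP k fun l hl => (hmem l hl).2.2
    have hx := algebraMap_X_sub_X_ne_zero hjk.symm
    refine ⟨c * d, ?_⟩
    rw [Finset.prod_inv_distrib, Finset.prod_inv_distrib, inv_sub_inv hPj hPk, hd, hc]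
    simp only [map_mul, map_prod]
    generalize algebraMap (MvPolynomial I ℂ) (FractionRing (MvPolynomial I ℂ))
      (X k - X j) = x at *
    field_simp

end
end

section
/- Let T be a tree on a finite set I. For all i, i' ∈ I, the following identity holds in the fraction field K: Σ_{j : i' ≤_T j ≤_T i} c_{i,j} · ∏_{j' : j' <_T i'} (x_{j'} − x_j) = 1 if i = i', and = 0 if i ≠ i'. In other words, the logarithmic 1-forms (ω_i)_{i∈I} form the dual basis to the basis (θ_{i'})_{i'∈I} of logarithmic vector fields. -/
noncomputable section

open MvPolynomial
open scoped Classical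

/-- The divided difference of the constant function `1`: the sum of the reciprocals of
`∏_{k ≠ j} (v k - v j)` over a nonempty set of distinct nodes is `1` for a single node
and `0` otherwise. -/
theorem sum_prod_inv_sub_eq_ite {ι F : Type*} [Field F] (s : Finset ι) (hs : s.Nonempty)
    (v : ι → F) (hv : Function.Injective v) :
    ∑ j ∈ s, ∏ k ∈ s.erase j, (v k - v j)⁻¹ = if s.card = 1 then 1 else 0 := by
  have hinj : Set.InjOn (fun j => -v j) s := fun a _ b _ h => hv (neg_injective h)
  have hdeg : (1 : Polynomial F).degree < s.card := by
    rw [Polynomial.degree_one]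
    exact_mod_cast hs.card_pos
  have h := Lagrange.coeff_eq_sum hinj hdeg
  simp only [Polynomial.eval_one, Polynomial.coeff_one, neg_sub_neg, one_div] at h
  simp only [Finset.prod_inv_distrib]
  rw [← h]
  have hpos := hs.card_pos
  congr 1
  simp only [eq_iff_iff]
  omega

theorem Forest.filter_le_ne_eq_union {I : Type*} [Fintype I] (T : Forest I) {i i' j : I}
    (hi : T.le i' i) (hj : T.le i' j) :
    Finset.univ.filter (fun k => T.le k i ∧ k ≠ j) =
      Finset.univ.filter (fun k => T.lt k i') ∪
        (Finset.univ.filter (fun k => T.le i' k ∧ T.le k i)).erase j := by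
  ext k
  simp only [Finset.mem_filter, Finset.mem_univ, true_and, Finset.mem_union, Finset.mem_erase]
  constructor
  · rintro ⟨hki, hkj⟩
    by_cases hk : T.le i' k
    · exact Or.inr ⟨hkj, hk, hki⟩
    · refine Or.inl ⟨(T.downset_chain hki hi).resolve_right hk, ?_⟩
      rintro rfl
      exact hk (T.le_refl k)
  · rintro (⟨hk, hne⟩ | ⟨hkj, -, hki⟩)
    · refine ⟨T.le_trans hk hi, ?_⟩
      rintro rfl
      exact hne (T.le_antisymm hk hj)
    · exact ⟨hki, hkj⟩

theorem Forest.card_interval_eq_one_iff {I : Type*} [Fintype I] (T : Forest I) {i i' : I}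
    (hi : T.le i' i) :
    (Finset.univ.filter (fun k => T.le i' k ∧ T.le k i)).card = 1 ↔ i = i' := by
  constructor
  · intro h
    exact Finset.card_le_one.mp h.le i (by simp [hi, T.le_refl]) i' (by simp [hi, T.le_refl])
  · rintro rfl
    rw [Finset.card_eq_one]
    refine ⟨i, Finset.ext fun k => ?_⟩
    simp only [Finset.mem_filter, Finset.mem_univ, true_and, Finset.mem_singleton]
    exact ⟨fun h => T.le_antisymm h.2 h.1, by rintro rfl; exact ⟨T.le_refl k, T.le_refl k⟩⟩

theorem omegaCoeff_mul_prod_eq {I : Type*} [Fintype I] (T : Forest I) {i i' j : I}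
    (hi : T.le i' i) (hj : T.le i' j) :
    omegaCoeff T i j * algebraMap (MvPolynomial I ℂ) (FractionRing (MvPolynomial I ℂ))
        (∏ j' ∈ Finset.univ.filter (fun j' => T.lt j' i'), (X j' - X j)) =
      ∏ k ∈ (Finset.univ.filter (fun k => T.le i' k ∧ T.le k i)).erase j,
        (algebraMap (MvPolynomial I ℂ) (FractionRing (MvPolynomial I ℂ)) (X k) -
          algebraMap (MvPolynomial I ℂ) (FractionRing (MvPolynomial I ℂ)) (X j))⁻¹ := by
  have hdisj : Disjoint (Finset.univ.filter (fun k => T.lt k i'))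
      ((Finset.univ.filter (fun k => T.le i' k ∧ T.le k i)).erase j) := by
    rw [Finset.disjoint_left]
    intro k hk hk'
    simp only [Finset.mem_filter, Finset.mem_univ, true_and, Finset.mem_erase] at hk hk'
    exact hk.2 (T.le_antisymm hk.1 hk'.2.1)
  have hne : ∏ k ∈ Finset.univ.filter (fun k => T.lt k i'),
      algebraMap (MvPolynomial I ℂ) (FractionRing (MvPolynomial I ℂ)) (X k - X j) ≠ 0 := by
    refine Finset.prod_ne_zero_iff.mpr fun k hk => ?_
    simp only [Finset.mem_filter, Finset.mem_univ, true_and] at hk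
    rw [map_ne_zero_iff _ (IsFractionRing.injective _ _), sub_ne_zero]
    intro h
    obtain rfl := X_injective h
    exact hk.2 (T.le_antisymm hk.1 hj)
  rw [omegaCoeff, T.filter_le_ne_eq_union hi hj, Finset.prod_union hdisj, map_prod,
    Finset.prod_inv_distrib, mul_right_comm, inv_mul_cancel₀ hne, one_mul]
  simp only [map_sub]

/-- `⟨ω_i, θ_{i'}⟩ = Σ_{i' ≤_T j ≤_T i} c_{i,j} · ∏_{j' <_T i'}
(x_{j'} - x_j)` equals `1` if `i = i'` and `0` otherwise: the logarithmic
1-forms `(ω_i)` form the dual basis to the basis `(θ_{i'})` of logarithmic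
vector fields. -/
theorem omega_dual_theta {I : Type*} [Fintype I] (T : Forest I) (hT : T.IsTree)
    (i i' : I) :
    (∑ j ∈ Finset.univ.filter (fun j => T.le i' j ∧ T.le j i),
        omegaCoeff T i j
          * algebraMap (MvPolynomial I ℂ) (FractionRing (MvPolynomial I ℂ))
              (∏ j' ∈ Finset.univ.filter (fun j' => T.lt j' i'), (X j' - X j)))
      = if i = i' then 1 else 0 := by
  by_cases hi : T.le i' i
  · have hsum := sum_prod_inv_sub_eq_ite
      (Finset.univ.filter (fun j => T.le i' j ∧ T.le j i)) ⟨i, by simp [hi, T.le_refl]⟩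
      (fun j => algebraMap (MvPolynomial I ℂ) (FractionRing (MvPolynomial I ℂ)) (X j))
      ((IsFractionRing.injective _ _).comp X_injective)
    simp only [T.card_interval_eq_one_iff hi] at hsum
    rw [← hsum]
    exact Finset.sum_congr rfl fun j hj =>
      omegaCoeff_mul_prod_eq T hi (Finset.mem_filter.mp hj).2.1
  · rw [if_neg (by rintro rfl; exact hi (T.le_refl _)), Finset.sum_eq_zero]
    intro j hj
    obtain ⟨-, h₁, h₂⟩ := Finset.mem_filter.mp hj
    exact absurd (T.le_trans h₁ h₂) hi

end
end

section
/- Let T be a tree on a finite set I. Consider the ℂ-linear map φ from the free ℂ-vector space with basis {e_{(i,j)} : i, j ∈ I, i <_T j} to the dual space of ℂ^I which sends e_{(i,j)} to the linear form α_{i,j} : x ↦ x_i − x_j. Then the kernel of φ is spanned by the elements e_{(i,j)} + e_{(j,k)} − e_{(i,k)} for i <_T j <_T k; that is, every linear relation between the forms α_{i,j} (i <_T j) is a linear combination of the relations α_{i,j} + α_{j,k} − α_{i,k} = 0. -/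
noncomputable section

/-- The linear form `α_{i,j} : x ↦ x_i - x_j` on `ℂ^I`. -/
def alphaForm {I : Type*} (i j : I) : Module.Dual ℂ (I → ℂ) :=
  (LinearMap.proj i : (I → ℂ) →ₗ[ℂ] ℂ) - LinearMap.proj j

open Classical in
/-- The basis vector of the edge `(r, j)`, or `0` when `r <_T j` fails. -/
def edgeFrom {I : Type*} (T : Forest I) (r j : I) : {p : I × I // T.lt p.1 p.2} →₀ ℂ :=
  if h : T.lt r j then Finsupp.single ⟨(r, j), h⟩ 1 else 0

open Classical in
/-- The linear map sending the `i`-th coordinate form to `edgeFrom T r i`. -/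
def edgeFromLift {I : Type*} [Fintype I] (T : Forest I) (r : I) :
    Module.Dual ℂ (I → ℂ) →ₗ[ℂ] ({p : I × I // T.lt p.1 p.2} →₀ ℂ) :=
  ∑ i, (LinearMap.applyₗ (Pi.single i 1 : I → ℂ)).smulRight (edgeFrom T r i)

theorem edgeFromLift_alphaForm {I : Type*} [Fintype I] (T : Forest I) (r i j : I) :
    edgeFromLift T r (alphaForm i j) = edgeFrom T r i - edgeFrom T r j := by
  classical
  simp [edgeFromLift, alphaForm, Pi.single_apply, sub_smul, Finset.sum_sub_distrib]

/-- the kernel of the map `e_{(i,j)} ↦ α_{i,j}` (for `i <_T j`) from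
the free vector space on the hyperplanes of `H_T` to the dual of `ℂ^I` is spanned
by the elements `e_{(i,j)} + e_{(j,k)} - e_{(i,k)}` for `i <_T j <_T k`: every
linear relation between the `α_{i,j}` is a combination of the relations
`α_{i,j} + α_{j,k} - α_{i,k} = 0`. -/
theorem relations_spanned {I : Type*} [Fintype I] (T : Forest I) (hT : T.IsTree) :
    LinearMap.ker (Finsupp.linearCombination ℂ
        (fun p : {p : I × I // T.lt p.1 p.2} => alphaForm p.1.1 p.1.2))
      = Submodule.span ℂ
          {v : {p : I × I // T.lt p.1 p.2} →₀ ℂ |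
            ∃ (i j k : I) (h₁ : T.lt i j) (h₂ : T.lt j k) (h₃ : T.lt i k),
              v = Finsupp.single ⟨(i, j), h₁⟩ 1 + Finsupp.single ⟨(j, k), h₂⟩ 1
                  - Finsupp.single ⟨(i, k), h₃⟩ 1} := by
  obtain ⟨r, hr⟩ := hT
  apply le_antisymm
  · intro v hv
    set S := Submodule.span ℂ
      {v : {p : I × I // T.lt p.1 p.2} →₀ ℂ |
        ∃ (i j k : I) (h₁ : T.lt i j) (h₂ : T.lt j k) (h₃ : T.lt i k),
          v = Finsupp.single ⟨(i, j), h₁⟩ 1 + Finsupp.single ⟨(j, k), h₂⟩ 1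
              - Finsupp.single ⟨(i, k), h₃⟩ 1}
    have edge_mem : ∀ p : {p : I × I // T.lt p.1 p.2},
        Finsupp.single p (1 : ℂ) + (edgeFrom T r p.1.1 - edgeFrom T r p.1.2) ∈ S := by
      rintro ⟨⟨i, j⟩, hij⟩
      have hrj : T.lt r j := by
        refine ⟨hr j, ?_⟩
        rintro rfl
        exact hij.2 (T.le_antisymm hij.1 (hr i))
      by_cases hri : r = i
      · subst hri
        have hrr : ¬ T.lt r r := fun h => h.2 rfl
        simp [edgeFrom, hrr, hrj]
      · have hlt : T.lt r i := ⟨hr i, hri⟩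
        refine Submodule.subset_span ⟨r, i, j, hlt, hij, hrj, ?_⟩
        simp only [edgeFrom, hlt, hrj, dite_true]
        abel
    have reduce : ∀ w : {p : I × I // T.lt p.1 p.2} →₀ ℂ,
        w + edgeFromLift T r (Finsupp.linearCombination ℂ
          (fun p : {p : I × I // T.lt p.1 p.2} => alphaForm p.1.1 p.1.2) w) ∈ S := by
      intro w
      induction w using Finsupp.induction_linear with
      | zero => simp
      | add f g hf hg =>
        rw [map_add, map_add, add_add_add_comm]
        exact S.add_mem hf hg
      | single p c =>
        rw [Finsupp.linearCombination_single, map_smul, edgeFromLift_alphaForm,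
          ← Finsupp.smul_single_one p c, ← smul_add]
        exact S.smul_mem c (edge_mem p)
    simpa [LinearMap.mem_ker.mp hv] using reduce v
  · rw [Submodule.span_le]
    rintro _ ⟨i, j, k, h₁, h₂, h₃, rfl⟩
    simp [alphaForm]

end
end

section
/- Let T be a tree on a finite set I. The complement ℝ^I \ ⋃_{(i,j) : i <_T j} {x ∈ ℝ^I : x_i = x_j} of the real arrangement H_T has exactly ∏_{i ∈ I} (Depth_T(i) + 1) connected components (chambers). -/
namespace Forest

variable {I : Type*}

/-- The depth of a vertex `i`: the number of vertices strictly below `i`. -/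
noncomputable def depth (T : Forest I) (i : I) : ℕ := Nat.card {k : I // T.lt k i}

end Forest

/-- A continuous surjection onto a discrete space with connected fibers induces a bijection from
connected components. -/
theorem ConnectedComponents.card_eq_of_fibers {X Y : Type*} [TopologicalSpace X]
    [TopologicalSpace Y] [DiscreteTopology Y] {f : X → Y} (hf : Continuous f)
    (hsurj : Function.Surjective f)
    (hfib : ∀ x y, f x = f y → y ∈ connectedComponent x) :
    Nat.card (ConnectedComponents X) = Nat.card Y := by
  refine Nat.card_congr (Equiv.ofBijective hf.connectedComponentsLift ⟨?_, ?_⟩)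
  · intro a b hab
    obtain ⟨x, rfl⟩ := ConnectedComponents.surjective_coe a
    obtain ⟨y, rfl⟩ := ConnectedComponents.surjective_coe b
    rw [Continuous.connectedComponentsLift_apply_coe,
      Continuous.connectedComponentsLift_apply_coe] at hab
    exact (ConnectedComponents.coe_eq_coe'.2 (hfib x y hab)).symm
  · intro y
    obtain ⟨x, rfl⟩ := hsurj y
    exact ⟨x, hf.connectedComponentsLift_apply_coe x⟩

/-- For every `m ≤ #S` some real number outside `S` lies above exactly `m` elements of `S`. -/
theorem Finset.exists_notMem_card_filter_lt_eq (S : Finset ℝ) (m : ℕ) (hm : m ≤ S.card) :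
    ∃ t : ℝ, t ∉ S ∧ (S.filter (· < t)).card = m := by
  induction S using Finset.induction_on_max generalizing m with
  | empty => exact ⟨0, by simp, by simp at hm ⊢; exact hm.symm⟩
  | insert a S ha ih =>
    have haS : a ∉ S := fun h => lt_irrefl a (ha a h)
    rw [Finset.card_insert_of_notMem haS] at hm
    rcases hm.eq_or_lt with rfl | hlt
    · refine ⟨a + 1, ?_, ?_⟩
      · intro h
        rcases Finset.mem_insert.1 h with h | h
        · linarith
        · linarith [ha _ h]
      · rw [Finset.filter_true_of_mem, Finset.card_insert_of_notMem haS]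
        intro x hx
        rcases Finset.mem_insert.1 hx with rfl | h
        · linarith
        · linarith [ha _ h]
    · obtain ⟨t, htS, ht⟩ := ih m (by omega)
      rcases lt_or_ge t a with hta | hta
      · refine ⟨t, ?_, ?_⟩
        · rw [Finset.mem_insert]; rintro (h | h)
          · exact hta.ne h
          · exact htS h
        · rw [Finset.filter_insert, if_neg hta.not_gt, ht]
      · have hSm : S.card = m := by
          rw [← ht, Finset.filter_true_of_mem fun x hx => (ha x hx).trans_le hta]
        obtain ⟨u, hua, hu⟩ : ∃ u < a, ∀ x ∈ S, x < u := by
          rcases S.eq_empty_or_nonempty with rfl | hne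
          · exact ⟨a - 1, by linarith, by simp⟩
          · obtain ⟨u, h1, h2⟩ := _root_.exists_between (ha _ (S.max'_mem hne))
            exact ⟨u, h2, fun x hx => (S.le_max' x hx).trans_lt h1⟩
        refine ⟨u, ?_, ?_⟩
        · rw [Finset.mem_insert]; rintro (h | h)
          · exact hua.ne h
          · exact lt_irrefl _ (hu _ h)
        · rw [Finset.filter_insert, if_neg hua.not_gt, Finset.filter_true_of_mem hu, hSm]

namespace Forest

variable {I : Type*}

theorem lt_trans (T : Forest I) {i j k : I} (hij : T.lt i j) (hjk : T.lt j k) : T.lt i k :=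
  ⟨T.le_trans hij.1 hjk.1, by rintro rfl; exact hij.2 (T.le_antisymm hij.1 hjk.1)⟩

theorem wellFounded_lt [Finite I] (T : Forest I) : WellFounded T.lt :=
  haveI : IsTrans I T.lt := ⟨fun _ _ _ => T.lt_trans⟩
  haveI : Std.Irrefl T.lt := ⟨fun _ h => h.2 rfl⟩
  Finite.wellFounded_of_trans_of_irrefl _

theorem lt_trichotomy_of_lt (T : Forest I) {i j k : I} (hj : T.lt j i) (hk : T.lt k i) :
    j = k ∨ T.lt j k ∨ T.lt k j := by
  by_cases h : j = k
  · exact .inl h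
  · exact .inr ((T.downset_chain hj.1 hk.1).imp (⟨·, h⟩) (⟨·, Ne.symm h⟩))

/-- The complement of the arrangement of the hyperplanes `x i = x j` for `i` below `j`. -/
def complement (T : Forest I) : Set (I → ℝ) := {x | ∀ i j : I, T.lt i j → x i ≠ x j}

theorem mem_connectedComponent_of_lt_iff_lt (T : Forest I) (x y : T.complement)
    (h : ∀ k i, T.lt k i → (x.1 k < x.1 i ↔ y.1 k < y.1 i)) : y ∈ connectedComponent x := by
  let C : Set (I → ℝ) := {z | ∀ k i, T.lt k i →
    (x.1 k < x.1 i → z k < z i) ∧ (x.1 i < x.1 k → z i < z k)}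
  have hC : Convex ℝ C := by
    have hlt : ∀ k i : I, Convex ℝ {z : I → ℝ | z k < z i} := by
      intro k i u hu v hv a b ha hb hab
      simp only [Set.mem_ofPred_eq, Pi.add_apply, Pi.smul_apply, smul_eq_mul] at hu hv ⊢
      rcases ha.eq_or_lt with rfl | ha
      · obtain rfl : b = 1 := by linarith
        simpa using hv
      · nlinarith [mul_lt_mul_of_pos_left hu ha, mul_le_mul_of_nonneg_left hv.le hb]
    intro u hu v hv a b ha hb hab k i hki
    exact ⟨fun hx => hlt k i ((hu k i hki).1 hx) ((hv k i hki).1 hx) ha hb hab,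
      fun hx => hlt i k ((hu k i hki).2 hx) ((hv k i hki).2 hx) ha hb hab⟩
  have hCr : C ⊆ Set.range (Subtype.val : T.complement → I → ℝ) := by
    rw [Subtype.range_coe]
    intro z hz k i hki
    rcases (x.2 k i hki).lt_or_gt with hx | hx
    · exact ((hz k i hki).1 hx).ne
    · exact ((hz k i hki).2 hx).ne'
  have hpre : IsPreconnected ((Subtype.val : T.complement → I → ℝ) ⁻¹' C) := by
    rw [← Topology.IsInducing.subtypeVal.isPreconnected_image,
      Set.image_preimage_eq_of_subset hCr]
    exact hC.isPreconnected
  refine hpre.subset_connectedComponent (fun k i _ => ⟨id, id⟩) fun k i hki => ⟨(h k i hki).1, ?_⟩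
  exact fun hx => lt_of_le_of_ne (not_lt.1 fun hy => hx.not_gt ((h k i hki).2 hy))
    (y.2 k i hki).symm

variable [Fintype I]

open Classical in
/-- The vertices strictly below `i`. -/
noncomputable def below (T : Forest I) (i : I) : Finset I := Finset.univ.filter fun k => T.lt k i

theorem mem_below {T : Forest I} {i k : I} : k ∈ T.below i ↔ T.lt k i := by simp [below]

theorem card_below (T : Forest I) (i : I) : (T.below i).card = T.depth i := by
  classical
  rw [depth, Nat.card_eq_fintype_card, Fintype.card_subtype]
  simp [below]

/-- The number of vertices below `i` whose coordinate is less than that of `i`. -/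
noncomputable def relRank (T : Forest I) (x : I → ℝ) (i : I) : Fin (T.depth i + 1) :=
  ⟨((T.below i).filter fun k => x k < x i).card,
    Nat.lt_succ_of_le ((Finset.card_filter_le _ _).trans_eq (T.card_below i))⟩

theorem relRank_congr (T : Forest I) {x y : I → ℝ}
    (h : ∀ k i, T.lt k i → (x k < x i ↔ y k < y i)) : T.relRank x = T.relRank y := by
  funext i
  refine Fin.ext (congrArg Finset.card (Finset.filter_congr fun k hk => h k i (mem_below.1 hk)))

theorem lt_iff_lt_of_relRank_eq (T : Forest I) {x y : I → ℝ} (hx : x ∈ T.complement)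
    (hy : y ∈ T.complement) (h : T.relRank x = T.relRank y) (i : I) :
    ∀ k, T.lt k i → (x k < x i ↔ y k < y i) := by
  induction i using T.wellFounded_lt.induction with
  | _ i ih =>
  have key : ∀ j k, T.lt j i → T.lt k i → (x j < x k ↔ y j < y k) := by
    intro j k hj hk
    rcases T.lt_trichotomy_of_lt hj hk with rfl | hjk | hkj
    · simp
    · exact ih k hk j hjk
    · have h1 := ih j hj k hkj
      have h2 := hx k j hkj
      have h3 := hy k j hkj
      constructor <;> intro h4
      · exact lt_of_le_of_ne (not_lt.1 fun h5 => h4.not_gt (h1.2 h5)) h3.symm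
      · exact lt_of_le_of_ne (not_lt.1 fun h5 => h4.not_gt (h1.1 h5)) h2.symm
  have hcard : ((T.below i).filter fun k => x k < x i).card =
      ((T.below i).filter fun k => y k < y i).card := congrArg Fin.val (congrFun h i)
  have heq : ((T.below i).filter fun k => x k < x i) =
      ((T.below i).filter fun k => y k < y i) := by
    by_cases hsub : ((T.below i).filter fun k => x k < x i) ⊆
        ((T.below i).filter fun k => y k < y i)
    · exact Finset.eq_of_subset_of_card_le hsub hcard.ge
    · refine (Finset.eq_of_subset_of_card_le ?_ hcard.le).symm
      obtain ⟨a, ha, hna⟩ := Finset.not_subset.1 hsub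
      simp only [Finset.mem_filter, mem_below, not_and, not_lt] at ha hna
      intro b hb
      simp only [Finset.mem_filter, mem_below] at hb ⊢
      exact ⟨hb.1, ((key b a hb.1 ha.1).2 (hb.2.trans_le (hna ha.1))).trans ha.2⟩
  intro k hk
  simpa [mem_below, hk] using Finset.ext_iff.1 heq k

theorem exists_relRank_eq (T : Forest I) (c : ∀ i, Fin (T.depth i + 1)) :
    ∃ x ∈ T.complement, T.relRank x = c := by
  classical
  have hg : ∀ (S : Finset ℝ) (m : ℕ), ∃ t : ℝ, m ≤ S.card →
      t ∉ S ∧ (S.filter (· < t)).card = m := fun S m => by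
    by_cases hm : m ≤ S.card
    · exact (S.exists_notMem_card_filter_lt_eq m hm).imp fun _ ht _ => ht
    · exact ⟨0, fun h => absurd h hm⟩
  choose g hg using hg
  let x : I → ℝ := T.wellFounded_lt.fix fun i ih =>
    g ((T.below i).attach.image fun k => ih k.1 (mem_below.1 k.2)) (c i)
  have hxi : ∀ i, x i = g ((T.below i).image x) (c i) := fun i => by
    refine (T.wellFounded_lt.fix_eq _ i).trans (congrArg (g · (c i)) ?_)
    ext t
    simp [x]
  have hspec : ∀ i, Set.InjOn x (T.below i) → x i ∉ (T.below i).image x ∧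
      (((T.below i).image x).filter (· < x i)).card = c i := fun i hinj => by
    rw [hxi i]
    refine hg _ _ ?_
    rw [Finset.card_image_of_injOn hinj, card_below]
    exact Nat.le_of_lt_succ (c i).2
  have hne : ∀ i k, T.lt k i → x k ≠ x i := fun i => by
    induction i using T.wellFounded_lt.induction with
    | _ i ih =>
    have hinj : Set.InjOn x (T.below i) := by
      intro j hj k hk hjk
      rcases T.lt_trichotomy_of_lt (mem_below.1 hj) (mem_below.1 hk) with h | h | h
      · exact h
      · exact absurd hjk (ih k (mem_below.1 hk) j h)
      · exact absurd hjk.symm (ih j (mem_below.1 hj) k h)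
    intro k hk hki
    exact (hspec i hinj).1 (hki ▸ Finset.mem_image_of_mem x (mem_below.2 hk))
  have hinj : ∀ i, Set.InjOn x (T.below i) := by
    intro i j hj k hk hjk
    rcases T.lt_trichotomy_of_lt (mem_below.1 hj) (mem_below.1 hk) with h | h | h
    · exact h
    · exact absurd hjk (hne k j h)
    · exact absurd hjk.symm (hne j k h)
  refine ⟨x, fun k i h => hne i k h, ?_⟩
  funext i
  refine Fin.ext ?_
  have h2 := (hspec i (hinj i)).2
  rw [Finset.filter_image, Finset.card_image_of_injOn
    ((hinj i).mono (Finset.coe_subset.2 (Finset.filter_subset _ _)))] at h2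
  exact h2

theorem continuous_relRank (T : Forest I) :
    Continuous fun x : T.complement => T.relRank x.1 := by
  refine IsLocallyConstant.continuous ((IsLocallyConstant.iff_eventually_eq _).2 fun x => ?_)
  have h : ∀ᶠ y : T.complement in nhds x, ∀ k i, T.lt k i → (y.1 k < y.1 i ↔ x.1 k < x.1 i) := by
    refine Filter.eventually_all.2 fun k => Filter.eventually_all.2 fun i => ?_
    by_cases hki : T.lt k i
    · have hk : Continuous fun y : T.complement => y.1 k :=
        (continuous_apply k).comp continuous_subtype_val
      have hi : Continuous fun y : T.complement => y.1 i :=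
        (continuous_apply i).comp continuous_subtype_val
      rcases (x.2 k i hki).lt_or_gt with h | h
      · filter_upwards [hk.continuousAt.eventually_lt hi.continuousAt h] with y hy _
        exact iff_of_true hy h
      · filter_upwards [hi.continuousAt.eventually_lt hk.continuousAt h] with y hy _
        exact iff_of_false hy.not_gt h.not_gt
    · exact Filter.Eventually.of_forall fun y h => absurd h hki
  exact h.mono fun y hy => T.relRank_congr hy

end Forest

/-- the complement of the real arrangement `H_T` in `ℝ^I` (the set of
points `x` with `x_i ≠ x_j` for all `i <_T j`) has exactly
`∏_{i ∈ I} (Depth(i) + 1)` connected components (chambers). -/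
theorem card_chambers {I : Type*} [Fintype I] (T : Forest I) (hT : T.IsTree) :
    Nat.card (ConnectedComponents
        {x : I → ℝ // ∀ i j : I, T.lt i j → x i ≠ x j})
      = ∏ i : I, (T.depth i + 1) := by
  have h := ConnectedComponents.card_eq_of_fibers T.continuous_relRank
    (fun c => by
      obtain ⟨x, hx, hxc⟩ := T.exists_relRank_eq c
      exact ⟨⟨x, hx⟩, hxc⟩)
    fun x y hxy => T.mem_connectedComponent_of_lt_iff_lt x y fun k i =>
      T.lt_iff_lt_of_relRank_eq x.2 y.2 hxy i k
  rw [Nat.card_pi] at h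
  simp only [Nat.card_fin] at h
  exact h
end

section
/- Let T be a tree on a finite set I. A partition π of I can be written as π(F) for some forest F on I with F ⊆ T if and only if every block of π has a unique minimal element for the partial order induced by ≤_T on that block. -/
namespace Forest

variable {I : Type*}

/-- A root of a forest: a minimal element. -/
def IsRoot (F : Forest I) (r : I) : Prop := ∀ j, F.le j r → j = r

/-- A node of a forest: a vertex which is not a root, i.e. has some vertex
strictly below it. -/
def IsNode (F : Forest I) (i : I) : Prop := ∃ j, F.lt j i

/-- The set `N(F)` of nodes of a forest. -/
def nodes (F : Forest I) : Set I := {i | F.IsNode i}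

/-- `i` and `j` lie in the same block of the partition `π(F)` of `I` associated
to `F`, i.e. they lie above a common root. -/
def sameBlock (F : Forest I) (i j : I) : Prop :=
  ∃ r, F.IsRoot r ∧ F.le r i ∧ F.le r j

/-- The partial order `⊆` on forests: `F' ⊆ F` iff `≤_{F'}` implies `≤_F` and
each tree of `F'` is induced by `F` as a poset (elements of a common block of
`π(F')` that are comparable in `F` are comparable in `F'`). -/
def Sub (F' F : Forest I) : Prop :=
  (∀ i j, F'.le i j → F.le i j) ∧
  (∀ i j, F'.sameBlock i j → F.le i j → F'.le i j)

end Forest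

namespace Forest

/-- In a finite forest, every vertex lies above a root. -/
theorem exists_isRoot_le {I : Type*} [Finite I] (F : Forest I) (i : I) :
    ∃ r, F.IsRoot r ∧ F.le r i := by
  let _ : PartialOrder I :=
    { le := F.le
      le_refl := F.le_refl
      le_trans := fun _ _ _ h h' => F.le_trans h h'
      le_antisymm := fun _ _ h h' => F.le_antisymm h h' }
  obtain ⟨r, hri, hr⟩ := (Set.toFinite (Set.univ : Set I)).exists_le_minimal (Set.mem_univ i)
  exact ⟨r, fun j hj => F.le_antisymm hj (hr.2 (Set.mem_univ j) hj), hri⟩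

/-- Two roots lying below a common vertex are equal. -/
theorem IsRoot.eq_of_le {I : Type*} {F : Forest I} {r s i : I} (hr : F.IsRoot r)
    (hs : F.IsRoot s) (hri : F.le r i) (hsi : F.le s i) : r = s :=
  (F.downset_chain hri hsi).elim (hs r) fun h => (hr s h).symm

/-- The forest obtained from `T` by keeping only the relations inside the blocks of a
partition. -/
def restrict {I : Type*} (T : Forest I) (P : Setoid I) : Forest I where
  le i j := P.r i j ∧ T.le i j
  le_refl i := ⟨P.refl i, T.le_refl i⟩
  le_trans _ _ _ h h' := ⟨P.trans h.1 h'.1, T.le_trans h.2 h'.2⟩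
  le_antisymm _ _ h h' := T.le_antisymm h.2 h'.2
  downset_chain _ _ _ h h' :=
    (T.downset_chain h.2 h'.2).imp (fun hl => ⟨P.trans h.1 (P.symm h'.1), hl⟩)
      (fun hl => ⟨P.trans h'.1 (P.symm h.1), hl⟩)

theorem rel_of_sameBlock_restrict {I : Type*} {T : Forest I} {P : Setoid I} {i j : I}
    (h : (T.restrict P).sameBlock i j) : P.r i j := by
  obtain ⟨r, -, hi, hj⟩ := h
  exact P.trans (P.symm hi.1) hj.1

theorem restrict_sub {I : Type*} (T : Forest I) (P : Setoid I) : (T.restrict P).Sub T :=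
  ⟨fun _ _ h => h.2, fun _ _ h hl => ⟨rel_of_sameBlock_restrict h, hl⟩⟩

end Forest

/-- a partition `π` of `I` (given as an equivalence relation, i.e.
a `Setoid`) is of the form `π(F)` for some forest `F ⊆ T` if and only if every
block of `π` has a unique minimal element for the order induced by `≤_T`. -/
theorem partition_of_subforest_iff {I : Type*} [Finite I]
    (T : Forest I) (hT : T.IsTree) (P : Setoid I) :
    (∃ F : Forest I, F.Sub T ∧ ∀ i j, (F.sameBlock i j ↔ P.r i j)) ↔
    (∀ i : I, ∃! m : I, P.r m i ∧ ∀ x, P.r x m → T.le x m → x = m) := by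
  constructor
  · rintro ⟨F, hF, hP⟩ i
    obtain ⟨r, hr, hri, -⟩ := (hP i i).2 (P.refl i)
    refine ⟨r, ⟨(hP r i).1 ⟨r, hr, F.le_refl r, hri⟩,
      fun x hx hl => hr x (hF.2 x r ((hP x r).2 hx) hl)⟩, ?_⟩
    rintro m ⟨hmi, hm⟩
    obtain ⟨s, hs, hsm, hsi⟩ := (hP m i).2 hmi
    obtain rfl := hr.eq_of_le hs hri hsi
    exact (hm r ((hP r m).1 ⟨r, hr, F.le_refl r, hsm⟩) (hF.1 r m hsm)).symm
  · intro h
    refine ⟨T.restrict P, T.restrict_sub P,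
      fun i j => ⟨Forest.rel_of_sameBlock_restrict, fun hij => ?_⟩⟩
    obtain ⟨r, hr, hri⟩ := (T.restrict P).exists_isRoot_le i
    obtain ⟨s, hs, hsj⟩ := (T.restrict P).exists_isRoot_le j
    obtain rfl : r = s := (h i).unique ⟨hri.1, fun x hx hl => hr x ⟨hx, hl⟩⟩
      ⟨P.trans hsj.1 (P.symm hij), fun x hx hl => hs x ⟨hx, hl⟩⟩
    exact ⟨r, hr, hri, hsj⟩
end

section
/- Let T be a tree on a finite set I and let F, F' be forests on I with F ⊆ T and F' ⊆ T. Then F ⊆ F' if and only if the partition π(F) is finer than the partition π(F') (every block of π(F) is contained in a block of π(F')). -/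
namespace Forest

/-- Two elements with a common lower bound lie in the same block. -/
theorem sameBlock_of_le_of_le {I : Type*} [Finite I] (F : Forest I) {k i j : I}
    (hi : F.le k i) (hj : F.le k j) : F.sameBlock i j := by
  obtain ⟨r, hr, hrk⟩ := F.exists_isRoot_le k
  exact ⟨r, hr, F.le_trans hrk hi, F.le_trans hrk hj⟩

end Forest

/-- for forests `F ⊆ T` and `F' ⊆ T`, one has `F ⊆ F'` if and only
if the partition `π(F)` is finer than the partition `π(F')`. -/
theorem sub_iff_partition_finer {I : Type*} [Finite I]
    (T : Forest I) (hT : T.IsTree) (F F' : Forest I)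
    (hF : F.Sub T) (hF' : F'.Sub T) :
    F.Sub F' ↔ (∀ i j, F.sameBlock i j → F'.sameBlock i j) := by
  constructor
  · rintro h i j ⟨r, -, hri, hrj⟩
    exact F'.sameBlock_of_le_of_le (h.1 r i hri) (h.1 r j hrj)
  · intro h
    exact ⟨fun i j hij =>
        hF'.2 i j (h i j (F.sameBlock_of_le_of_le (F.le_refl i) hij)) (hF.1 i j hij),
      fun i j hb hij => hF.2 i j hb (hF'.1 i j hij)⟩
end

section
/- Let T be a tree on a finite set I. The map sending a forest F (with F ⊆ T) to the subspace a_F = {x ∈ ℂ^I : x_i = x_j whenever i ≤_F j} is an order isomorphism from the poset ({forests F on I : F ⊆ T}, ⊆) onto the intersection lattice L_T ordered by reverse inclusion. In particular, the interval between the minimal forest 0̂ (the discrete order on I) and T in the poset of forests on I is isomorphic to L_T. -/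
noncomputable section

open scoped Classical

/-- The hyperplane `{x : x_i = x_j}` of `ℂ^I`, as a subspace. -/
def eqSubspace {I : Type*} (i j : I) : Submodule ℂ (I → ℂ) :=
  LinearMap.ker ((LinearMap.proj i : (I → ℂ) →ₗ[ℂ] ℂ) - LinearMap.proj j)

/-- The intersection lattice `L_T` of the arrangement `H_T`: all intersections of
hyperplanes `{x_i = x_j}` with `i <_T j` (the empty intersection being `ℂ^I`). -/
def intersectionLattice {I : Type*} [Fintype I] (T : Forest I) :
    Finset (Submodule ℂ (I → ℂ)) :=
  (Finset.univ.filter (fun p : I × I => T.lt p.1 p.2)).powerset.image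
    (fun S => S.inf (fun p => eqSubspace p.1 p.2))

/-- The subspace `a_F = {x ∈ ℂ^I : x_i = x_j whenever i ≤_F j}` associated to a
forest `F`. -/
def forestSubspace {I : Type*} (F : Forest I) : Submodule ℂ (I → ℂ) :=
  ⨅ (i : I) (j : I) (_ : F.le i j), eqSubspace i j

theorem mem_eqSubspace {I : Type*} {i j : I} {x : I → ℂ} : x ∈ eqSubspace i j ↔ x i = x j := by
  simp [eqSubspace, sub_eq_zero]

theorem mem_forestSubspace {I : Type*} {F : Forest I} {x : I → ℂ} :
    x ∈ forestSubspace F ↔ ∀ i j, F.le i j → x i = x j := by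
  simp [forestSubspace, Submodule.mem_iInf, mem_eqSubspace]

theorem mem_finset_inf_eqSubspace {I : Type*} {S : Finset (I × I)} {x : I → ℂ} :
    x ∈ S.inf (fun p => eqSubspace p.1 p.2) ↔ ∀ p ∈ S, x p.1 = x p.2 := by
  simp only [Submodule.mem_finsetInf, mem_eqSubspace]

theorem Forest.exists_isRoot_le_s12 {I : Type*} [Finite I] (F : Forest I) (i : I) :
    ∃ r, F.IsRoot r ∧ F.le r i := by
  let _ : PartialOrder I :=
    { le := F.le
      le_refl := F.le_refl
      le_trans := fun _ _ _ h h' => F.le_trans h h'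
      le_antisymm := fun _ _ h h' => F.le_antisymm h h' }
  obtain ⟨r, hri, hr⟩ := Set.finite_univ.exists_le_minimal (Set.mem_univ i)
  exact ⟨r, fun j hj => F.le_antisymm hj (hr.2 (Set.mem_univ j) hj), hri⟩

/-- Coordinates that agree on all of `a_F` are indexed by elements of a common block of `π(F)`. -/
theorem Forest.sameBlock_of_forestSubspace_le {I : Type*} [Finite I] {F : Forest I} {i j : I}
    (h : forestSubspace F ≤ eqSubspace i j) : F.sameBlock i j := by
  obtain ⟨r, hr, hri⟩ := F.exists_isRoot_le_s12 i
  refine ⟨r, hr, hri, ?_⟩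
  have hx : (fun k => if F.le r k then (1 : ℂ) else 0) ∈ forestSubspace F := by
    refine mem_forestSubspace.2 fun k l hkl => if_congr ⟨fun hrk => F.le_trans hrk hkl, ?_⟩ rfl rfl
    intro hrl
    rcases F.downset_chain hrl hkl with hrk | hkr
    · exact hrk
    · exact hr k hkr ▸ F.le_refl k
  have hij := mem_eqSubspace.1 (h hx)
  by_contra hrj
  simp [hri, hrj] at hij

/-- The forest obtained from `T` by keeping the relations between coordinates that agree on `W`. -/
def Forest.ofSubspace {I : Type*} (T : Forest I) (W : Submodule ℂ (I → ℂ)) : Forest I where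
  le i j := T.le i j ∧ ∀ x ∈ W, x i = x j
  le_refl i := ⟨T.le_refl i, fun _ _ => rfl⟩
  le_trans _ _ _ h h' := ⟨T.le_trans h.1 h'.1, fun x hx => (h.2 x hx).trans (h'.2 x hx)⟩
  le_antisymm _ _ h h' := T.le_antisymm h.1 h'.1
  downset_chain _ _ _ h h' := (T.downset_chain h.1 h'.1).imp
    (fun hjk => ⟨hjk, fun x hx => (h.2 x hx).trans (h'.2 x hx).symm⟩)
    (fun hkj => ⟨hkj, fun x hx => (h'.2 x hx).trans (h.2 x hx).symm⟩)

theorem Forest.ofSubspace_sub {I : Type*} (T : Forest I) (W : Submodule ℂ (I → ℂ)) :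
    (T.ofSubspace W).Sub T := by
  refine ⟨fun i j h => h.1, ?_⟩
  rintro i j ⟨r, -, hri, hrj⟩ hij
  exact ⟨hij, fun x hx => (hri.2 x hx).symm.trans (hrj.2 x hx)⟩

/-- `F ↦ a_F` is an order isomorphism from the poset of forests
`F ⊆ T` (ordered by `⊆`) onto the intersection lattice `L_T` ordered by reverse
inclusion; in particular the interval `[0̂, T]` in the poset of forests on `I`
is isomorphic to `L_T`. -/
theorem forest_poset_iso_lattice {I : Type*} [Fintype I]
    (T : Forest I) (hT : T.IsTree) :
    (∀ F : Forest I, F.Sub T → forestSubspace F ∈ intersectionLattice T) ∧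
    (∀ W ∈ intersectionLattice T, ∃ F : Forest I, F.Sub T ∧ forestSubspace F = W) ∧
    (∀ F F' : Forest I, F.Sub T → F'.Sub T →
      (F.Sub F' ↔ forestSubspace F' ≤ forestSubspace F)) := by
  refine ⟨fun F hF => ?_, fun W hW => ?_, fun F F' hF hF' => ⟨fun h x hx => ?_, fun h => ⟨?_, ?_⟩⟩⟩
  · refine Finset.mem_image.2 ⟨Finset.univ.filter (fun p : I × I => F.lt p.1 p.2), ?_, ?_⟩
    · refine Finset.mem_powerset.2 (Finset.monotone_filter_right _ ?_)
      exact fun p _ hp => ⟨hF.1 _ _ hp.1, hp.2⟩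
    · ext x
      rw [mem_finset_inf_eqSubspace, mem_forestSubspace]
      simp only [Finset.mem_filter_univ]
      refine ⟨fun h i j hij => ?_, fun h p hp => h _ _ hp.1⟩
      by_cases hne : i = j
      · rw [hne]
      · exact h (i, j) ⟨hij, hne⟩
  · obtain ⟨S, hS, rfl⟩ := Finset.mem_image.1 hW
    refine ⟨T.ofSubspace (S.inf fun p => eqSubspace p.1 p.2), T.ofSubspace_sub _,
      le_antisymm (fun x hx => ?_) (fun x hx => ?_)⟩
    · refine mem_finset_inf_eqSubspace.2 fun p hp => mem_forestSubspace.1 hx _ _ ⟨?_, ?_⟩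
      · exact ((Finset.mem_filter_univ p).1 (Finset.mem_powerset.1 hS hp)).1
      · exact fun y hy => mem_finset_inf_eqSubspace.1 hy p hp
    · exact mem_forestSubspace.2 fun i j hij => hij.2 x hx
  · exact mem_forestSubspace.2 fun i j hij => mem_forestSubspace.1 hx _ _ (h.1 _ _ hij)
  · intro i j hij
    refine hF'.2 i j (Forest.sameBlock_of_forestSubspace_le fun x hx => ?_) (hF.1 i j hij)
    exact mem_eqSubspace.2 (mem_forestSubspace.1 (h hx) i j hij)
  · exact fun i j hb hij => hF.2 i j hb (hF'.1 i j hij)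

end
end
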